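/- (Order 3−α approximation of the Caputo derivative.) Let 0 < α < 1, x > 0, and let y be smooth (C^∞) on [0, x]. Define S_n[β] = Σ_{k=1}^{n−1} k^{−β} − ζ(β), K₁ = n S_n[α+1] − S_n[α] + n^{1−α}/(α(1−α)), K₂ = (n²/2) S_n[α+1] − n S_n[α] + (1/2) S_n[α−1] + n^{2−α}/(α(α−1)(α−2)), and weights ω₀ = −ζ(1+α), ω_k = k^{−1−α} for 1 ≤ k ≤ n−1, ω_n = ζ(1+α) − Σ_{k=1}^{n−1} k^{−1−α}; then set δ₀ = −ζ(1+α) + (3/2)ζ(α) − (1/2)ζ(α−1), δ₁ = 1 − 2ζ(α) + ζ(α−1), δ₂ = 2^{−1−α} + (1/2)ζ(α) − (1/2)ζ(α−1), δ_k = k^{−1−α} for 3 ≤ k ≤ n−3, δ_{n−2} = ω_{n−2} + (1/2)K₁ − K₂, δ_{n−1} = ω_{n−1} − 2K₁ + 2K₂, δ_n = ω_n + (3/2)K₁ − K₂. Then there exists C > 0 (independent of n) such that for all integers n ≥ 6, with h = x/n, | (1/(Γ(−α)h^α)) Σ_{k=0}^{n} δ_k y(x−kh) − D^α y(x) | ≤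 C h^{3−α}. -/

import Mathlib

/-- Real values of the Riemann zeta function at real arguments
(real part of the analytic continuation). -/
noncomputable def zr (s : ℝ) : ℝ := (riemannZeta s).re

/-- The Caputo derivative of order `α` of `y` at `x`. -/
noncomputable def caputo (α : ℝ) (y : ℝ → ℝ) (x : ℝ) : ℝ :=
  (1 / Real.Gamma (1 - α)) * ∫ t in (0:ℝ)..x, deriv y t / (x - t) ^ α

/-- `S_n[β] = Σ_{k=1}^{n−1} k^{−β} − ζ(β)`. -/
noncomputable def S (n : ℕ) (β : ℝ) : ℝ :=
  (∑ k ∈ Finset.Icc 1 (n - 1), (k:ℝ) ^ (-β)) - zr β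

/-- `K₁ = n S_n[α+1] − S_n[α] + n^{1−α}/(α(1−α))`. -/
noncomputable def K1 (n : ℕ) (α : ℝ) : ℝ :=
  (n:ℝ) * S n (α + 1) - S n α + (n:ℝ) ^ (1 - α) / (α * (1 - α))

/-- `K₂ = (n²/2) S_n[α+1] − n S_n[α] + (1/2) S_n[α−1] + n^{2−α}/(α(α−1)(α−2))`. -/
noncomputable def K2 (n : ℕ) (α : ℝ) : ℝ :=
  (n:ℝ) ^ 2 / 2 * S n (α + 1) - (n:ℝ) * S n α + (1 / 2) * S n (α - 1)
    + (n:ℝ) ^ (2 - α) / (α * (α - 1) * (α - 2))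

section

open Set Filter Topology MeasureTheory

section EulerMaclaurin

variable {E : Type*} [NormedAddCommGroup E] [NormedSpace ℝ E]

/-- A function on `[a, b]` vanishing at `a` whose derivative is bounded by `M` is bounded by
`M * (b - a)`. -/
theorem norm_le_of_hasDerivAt_of_eq_zero {f f' : ℝ → E} {a b M : ℝ}
    (hf : ∀ t ∈ Icc a b, HasDerivAt f (f' t) t) (hM : ∀ t ∈ Icc a b, ‖f' t‖ ≤ M)
    (ha : f a = 0) : ∀ t ∈ Icc a b, ‖f t‖ ≤ M * (b - a) := by
  intro t ht
  have hab : a ≤ b := ht.1.trans ht.2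
  have h := (convex_Icc a b).norm_image_sub_le_of_norm_hasDerivWithin_le
    (fun u hu => (hf u hu).hasDerivWithinAt) hM (left_mem_Icc.2 hab) ht
  rw [ha, sub_zero, Real.norm_of_nonneg (sub_nonneg.2 ht.1)] at h
  have hM0 : 0 ≤ M := (norm_nonneg _).trans (hM t ht)
  exact h.trans (by gcongr; exact ht.2)

/-- One step of the trapezoidal rule with endpoint-derivative correction. -/
theorem norm_corrected_trapezoid_le {F f f₁ f₂ f₃ : ℝ → E} {a b M : ℝ} (hab : a ≤ b)
    (hF : ∀ t ∈ Icc a b, HasDerivAt F (f t) t) (hf : ∀ t ∈ Icc a b, HasDerivAt f (f₁ t) t)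
    (hf₁ : ∀ t ∈ Icc a b, HasDerivAt f₁ (f₂ t) t) (hf₂ : ∀ t ∈ Icc a b, HasDerivAt f₂ (f₃ t) t)
    (hM : ∀ t ∈ Icc a b, ‖f₃ t‖ ≤ M) :
    ‖F b - F a - ((b - a) / 2) • (f a + f b) + ((b - a) ^ 2 / 12) • (f₁ b - f₁ a)‖
      ≤ M * (b - a) ^ 4 := by
  have hM0 : 0 ≤ M := (norm_nonneg _).trans (hM a (left_mem_Icc.2 hab))
  have hlin : ∀ t, HasDerivAt (fun t : ℝ => t - a) 1 t := fun t => (hasDerivAt_id t).sub_const a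
  have hψ : ∀ t ∈ Icc a b, ‖f₁ t - f₁ a - (t - a) • f₂ t‖ ≤ M * (b - a) * (b - a) := by
    refine norm_le_of_hasDerivAt_of_eq_zero (f' := fun t => -((t - a) • f₃ t)) ?_ ?_ (by simp)
    · intro t ht
      refine (((hf₁ t ht).sub_const (f₁ a)).sub ((hlin t).smul (hf₂ t ht))).congr_deriv ?_
      module
    · intro t ht
      rw [norm_neg, norm_smul, Real.norm_of_nonneg (sub_nonneg.2 ht.1), mul_comm]
      gcongr
      · exact sub_nonneg.2 ht.1
      · exact hM t ht
      · exact ht.2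
  have hφ₁ : ∀ t ∈ Icc a b, ‖(1 / 2 : ℝ) • (f t - f a) - (t - a) • ((1 / 3 : ℝ) • f₁ t
      + (1 / 6 : ℝ) • f₁ a) + ((t - a) ^ 2 / 12) • f₂ t‖ ≤ M * (b - a) ^ 2 * (b - a) := by
    refine norm_le_of_hasDerivAt_of_eq_zero
      (f' := fun t => (1 / 6 : ℝ) • (f₁ t - f₁ a - (t - a) • f₂ t) + ((t - a) ^ 2 / 12) • f₃ t)
      ?_ ?_ (by simp)
    · intro t ht
      refine (((((hf t ht).sub_const (f a)).const_smul (1 / 2 : ℝ)).sub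
        ((hlin t).smul (((hf₁ t ht).const_smul (1 / 3 : ℝ)).add_const _))).add
        ((((hlin t).pow 2).div_const 12).smul (hf₂ t ht))).congr_deriv ?_
      simp only [Pi.smul_apply, Pi.pow_apply]
      module
    · intro t ht
      have h1 := hψ t ht
      have h2 : (t - a) ^ 2 * ‖f₃ t‖ ≤ (b - a) ^ 2 * M := by
        have := hM t ht
        have h0 := sub_nonneg.2 ht.1
        have := ht.2
        gcongr
      refine (norm_add_le _ _).trans ?_
      rw [norm_smul, norm_smul, Real.norm_of_nonneg (by norm_num),
        Real.norm_of_nonneg (by positivity)]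
      nlinarith [mul_nonneg hM0 (sq_nonneg (b - a))]
  have hφ : ∀ t ∈ Icc a b, ‖F t - F a - ((t - a) / 2) • (f a + f t)
      + ((t - a) ^ 2 / 12) • (f₁ t - f₁ a)‖ ≤ M * (b - a) ^ 2 * (b - a) * (b - a) := by
    refine norm_le_of_hasDerivAt_of_eq_zero (f' := fun t => (1 / 2 : ℝ) • (f t - f a)
      - (t - a) • ((1 / 3 : ℝ) • f₁ t + (1 / 6 : ℝ) • f₁ a) + ((t - a) ^ 2 / 12) • f₂ t)
      ?_ hφ₁ (by simp)
    intro t ht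
    refine ((((hF t ht).sub_const (F a)).sub (((hlin t).div_const 2).smul
      ((hf t ht).const_add (f a)))).add
      ((((hlin t).pow 2).div_const 12).smul ((hf₁ t ht).sub_const (f₁ a)))).congr_deriv ?_
    simp only [Pi.pow_apply]
    module
  refine (hφ b (right_mem_Icc.2 hab)).trans_eq ?_
  ring

end EulerMaclaurin

section Zeta

/-- `(s - 1)` times the Euler–Maclaurin approximation of `ζ(s)` by `N` terms of the series. -/
noncomputable def zetaEM (N : ℕ) (s : ℂ) : ℂ :=
  (s - 1) * (∑ k ∈ Finset.range N, ((k + 1 : ℝ) : ℂ) ^ (-s) + ((N + 1 : ℝ) : ℂ) ^ (-s) / 2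
    + s / 12 * ((N + 1 : ℝ) : ℂ) ^ (-s - 1)) + ((N + 1 : ℝ) : ℂ) ^ (1 - s)

theorem hasDerivAt_ofReal_cpow {t : ℝ} (ht : 0 < t) (r : ℂ) :
    HasDerivAt (fun u : ℝ => (u : ℂ) ^ r) (r * (t : ℂ) ^ (r - 1)) t := by
  rcases eq_or_ne r 0 with rfl | hr
  · simpa using hasDerivAt_const t (1 : ℂ)
  · exact hasDerivAt_ofReal_cpow_const ht.ne' hr

theorem norm_zetaEM_succ_sub_le (N : ℕ) {s : ℂ} (hs : -3 ≤ s.re) :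
    ‖zetaEM (N + 1) s - zetaEM N s‖
      ≤ ‖s - 1‖ * ‖s‖ * ‖s + 1‖ * ‖s + 2‖ * (N + 1 : ℝ) ^ (-s.re - 3) := by
  have hpos : ∀ t ∈ Icc (N + 1 : ℝ) (N + 2), 0 < t := fun t ht =>
    lt_of_lt_of_le (by positivity) ht.1
  have key := norm_corrected_trapezoid_le (a := (N + 1 : ℝ)) (b := N + 2)
    (F := fun t : ℝ => -(t : ℂ) ^ (1 - s))
    (f := fun t : ℝ => (s - 1) * (t : ℂ) ^ (-s))
    (f₁ := fun t : ℝ => (s - 1) * (-s) * (t : ℂ) ^ (-s - 1))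
    (f₂ := fun t : ℝ => (s - 1) * (-s) * (-s - 1) * (t : ℂ) ^ (-s - 2))
    (f₃ := fun t : ℝ => (s - 1) * (-s) * (-s - 1) * (-s - 2) * (t : ℂ) ^ (-s - 3))
    (M := ‖s - 1‖ * ‖s‖ * ‖s + 1‖ * ‖s + 2‖ * (N + 1 : ℝ) ^ (-s.re - 3))
    (by linarith) ?_ ?_ ?_ ?_ ?_
  · have e : (N + 2 - (N + 1) : ℝ) = 1 := by ring
    have e2 : ((N + 1 : ℕ) + 1 : ℝ) = N + 2 := by push_cast; ring
    rw [e] at key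
    simp only [Complex.real_smul, one_pow, mul_one] at key
    rw [← norm_neg] at key
    refine le_of_eq_of_le (congrArg norm ?_) key
    simp only [zetaEM, Finset.sum_range_succ, e2]
    push_cast
    ring
  · intro t ht
    refine (hasDerivAt_ofReal_cpow (hpos t ht) (1 - s)).neg.congr_deriv ?_
    rw [show 1 - s - 1 = -s by ring]
    ring
  · intro t ht
    refine ((hasDerivAt_ofReal_cpow (hpos t ht) (-s)).const_mul _).congr_deriv ?_
    ring
  · intro t ht
    refine ((hasDerivAt_ofReal_cpow (hpos t ht) (-s - 1)).const_mul _).congr_deriv ?_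
    rw [show -s - 1 - 1 = -s - 2 by ring]
    ring
  · intro t ht
    refine ((hasDerivAt_ofReal_cpow (hpos t ht) (-s - 2)).const_mul _).congr_deriv ?_
    rw [show -s - 2 - 1 = -s - 3 by ring]
    ring
  · intro t ht
    rw [norm_mul, norm_mul, norm_mul, norm_mul, Complex.norm_cpow_eq_rpow_re_of_pos (hpos t ht),
      norm_neg, show -s - 1 = -(s + 1) by ring, show -s - 2 = -(s + 2) by ring, norm_neg, norm_neg]
    have : t ^ (-s - 3).re ≤ (N + 1 : ℝ) ^ (-s.re - 3) := by
      simp only [Complex.sub_re, Complex.neg_re, Complex.re_ofNat]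
      exact Real.rpow_le_rpow_of_nonpos (by positivity) ht.1 (by linarith)
    gcongr

theorem differentiable_zetaEM (N : ℕ) : Differentiable ℂ (zetaEM N) := by
  have h : ∀ (k : ℕ) (f : ℂ → ℂ), Differentiable ℂ f →
      Differentiable ℂ fun s => ((k + 1 : ℝ) : ℂ) ^ f s := fun k f hf s =>
    (hf s).const_cpow (Or.inl (by exact_mod_cast (Nat.succ_ne_zero k)))
  have h1 := h N (fun s => -s) (by fun_prop)
  have h2 := h N (fun s => -s - 1) (by fun_prop)
  have h3 := h N (fun s => 1 - s) (by fun_prop)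
  have h4 : Differentiable ℂ fun s : ℂ => ∑ k ∈ Finset.range N, ((k + 1 : ℝ) : ℂ) ^ (-s) :=
    Differentiable.fun_sum fun k _ => h k (fun s => -s) (by fun_prop)
  unfold zetaEM
  fun_prop

theorem tendsto_zetaEM {s : ℂ} (hs : 1 < s.re) :
    Tendsto (fun N => zetaEM N s) atTop (𝓝 (riemannZeta₁ s)) := by
  have hpow : ∀ r : ℂ, r.re < 0 →
      Tendsto (fun N : ℕ => ((N + 1 : ℝ) : ℂ) ^ r) atTop (𝓝 0) := by
    intro r hr
    rw [tendsto_zero_iff_norm_tendsto_zero]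
    have : ∀ N : ℕ, ‖((N + 1 : ℝ) : ℂ) ^ r‖ = (N + 1 : ℝ) ^ (-(-r.re)) := fun N => by
      rw [Complex.norm_cpow_eq_rpow_re_of_pos (by positivity), neg_neg]
    simp only [this]
    exact (tendsto_rpow_neg_atTop (neg_pos.2 hr)).comp
      (tendsto_atTop_add_const_right _ _ tendsto_natCast_atTop_atTop)
  have hsum : Tendsto (fun N => ∑ k ∈ Finset.range N, ((k + 1 : ℝ) : ℂ) ^ (-s)) atTop
      (𝓝 (riemannZeta s)) := by
    have h1 : Summable fun k : ℕ => ((k + 1 : ℝ) : ℂ) ^ (-s) := by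
      have := (summable_nat_add_iff 1).2 (Complex.summable_one_div_nat_cpow.2 hs)
      refine this.congr fun k => ?_
      rw [Complex.cpow_neg]
      push_cast
      simp
    rw [zeta_eq_tsum_one_div_nat_add_one_cpow hs]
    convert h1.hasSum.tendsto_sum_nat using 2
    refine tsum_congr fun k => ?_
    rw [Complex.cpow_neg]
    push_cast
    simp
  have h1 : s ≠ 1 := by
    rintro rfl
    simp at hs
  have := ((((hsum.add ((hpow (-s) (by simp; linarith)).div_const 2)).add
    ((hpow (-s - 1) (by simp; linarith)).const_mul (s / 12))).const_mul (s - 1))).add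
    (hpow (1 - s) (by simp; linarith))
  have e : (s - 1) * (riemannZeta s + 0 / 2 + s / 12 * 0) + 0 = riemannZeta₁ s := by
    have h2 := sub_ne_zero.2 h1
    rw [riemannZeta_eq_inv_sub_mul h1]
    field_simp
    simp
  rw [e] at this
  exact this

theorem hasSum_zetaEM_sub (N : ℕ) {s : ℂ} (hs : -1 < s.re) :
    HasSum (fun j : ℕ => zetaEM (N + j + 1) s - zetaEM (N + j) s)
      (riemannZeta₁ s - zetaEM N s) := by
  set B : ℂ → ℕ → ℂ := fun s j => zetaEM (N + j + 1) s - zetaEM (N + j) s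
  have hsummable : ∀ c : ℝ, Summable fun j : ℕ => c * ((N + j : ℕ) + 1 : ℝ) ^ (-2 : ℝ) := by
    intro c
    refine Summable.mul_left c ?_
    have := (summable_nat_add_iff (N + 1)).2
      (Real.summable_nat_rpow.2 (by norm_num : (-2 : ℝ) < -1))
    refine this.congr fun j => ?_
    congr 1
    push_cast
    ring
  have hbound : ∀ (K : ℝ) (z : ℂ), -1 < z.re → ‖z‖ ≤ K → ∀ j,
      ‖B z j‖ ≤ ((K + 1) * K * (K + 1) * (K + 2)) * ((N + j : ℕ) + 1 : ℝ) ^ (-2 : ℝ) := by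
    intro K z hz hK j
    have hK0 : 0 ≤ K := (norm_nonneg _).trans hK
    refine (norm_zetaEM_succ_sub_le (N + j) (by linarith)).trans ?_
    have h1 : ‖z - 1‖ ≤ K + 1 := (norm_sub_le _ _).trans (by simpa)
    have h2 : ‖z + 1‖ ≤ K + 1 := (norm_add_le _ _).trans (by simpa)
    have h3 : ‖z + 2‖ ≤ K + 2 := (norm_add_le _ _).trans (by simpa)
    have h4 : ((N + j : ℕ) + 1 : ℝ) ^ (-z.re - 3) ≤ ((N + j : ℕ) + 1 : ℝ) ^ (-2 : ℝ) :=
      Real.rpow_le_rpow_of_exponent_le (by linarith [Nat.cast_nonneg (α := ℝ) (N + j)])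
        (by linarith)
    gcongr
  have hB_sum : ∀ z : ℂ, -1 < z.re → Summable (B z) := fun z hz =>
    Summable.of_norm_bounded (hsummable _) (hbound _ z hz le_rfl)
  set K : ℝ := ‖s‖ + 3
  set V : Set ℂ := {z | -1 < z.re} ∩ Metric.ball 0 K
  have hV : IsOpen V := (isOpen_lt continuous_const Complex.continuous_re).inter Metric.isOpen_ball
  have hVc : Convex ℝ V := (convex_halfSpace_re_gt _).inter (convex_ball _ _)
  have hsV : s ∈ V := ⟨hs, by simp [K]⟩
  have h2V : (2 : ℂ) ∈ V := ⟨by simp; norm_num, by simp [K]; linarith [norm_nonneg s]⟩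
  have hdiff : DifferentiableOn ℂ (fun z => ∑' j, B z j) V := by
    refine Complex.differentiableOn_tsum_of_summable_norm (hsummable _) (fun j => ?_) hV
      fun j z hz => hbound K z hz.1 (by simpa using (mem_ball_zero_iff.1 hz.2).le) j
    exact ((differentiable_zetaEM _).sub (differentiable_zetaEM _)).differentiableOn
  have heq : EqOn (fun z => ∑' j, B z j) (fun z => riemannZeta₁ z - zetaEM N z) V := by
    refine (hdiff.analyticOnNhd hV).eqOn_of_preconnected_of_eventuallyEq
      ((differentiable_riemannZeta₁.sub (differentiable_zetaEM N)).differentiableOn.analyticOnNhd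
        hV) hVc.isPreconnected h2V ?_
    have : {z : ℂ | 1 < z.re} ∈ 𝓝 (2 : ℂ) :=
      (isOpen_lt continuous_const Complex.continuous_re).mem_nhds (by simp)
    filter_upwards [this] with z hz
    have hz' : 1 < z.re := hz
    refine tendsto_nhds_unique (hB_sum z (by linarith)).hasSum.tendsto_sum_nat ?_
    have h := ((tendsto_zetaEM hz').comp (tendsto_add_atTop_nat N)).sub_const (zetaEM N z)
    refine h.congr fun n => ?_
    have := Finset.sum_range_sub (fun j => zetaEM (N + j) z) n
    simp only [Function.comp, add_comm n N]
    exact this.symm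
  rw [← show ∑' j, B s j = riemannZeta₁ s - zetaEM N s from heq hsV]
  exact (hB_sum s hs).hasSum

end Zeta

/-- Euler–Maclaurin asymptotics of `S n β` as `n → ∞`. -/
theorem exists_abs_S_sub_le {β ε : ℝ} (hβ : -1 < β) (hβ1 : β ≠ 1) (hε : 0 < ε)
    (hεβ : ε ≤ β + 2) :
    ∃ C : ℝ, 0 ≤ C ∧ ∀ n : ℕ, 1 ≤ n →
      |S n β - ((n : ℝ) ^ (1 - β) / (1 - β) - (n : ℝ) ^ (-β) / 2 - β / 12 * (n : ℝ) ^ (-β - 1))|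
        ≤ C * (n : ℝ) ^ (-β - 2 + ε) := by
  have hβ1' : (β : ℂ) ≠ 1 := by exact_mod_cast hβ1
  have hβ0 : β - 1 ≠ 0 := sub_ne_zero.2 hβ1
  have hsum : Summable fun j : ℕ => (j + 1 : ℝ) ^ (-(1 + ε)) := by
    have := (summable_nat_add_iff 1).2 (Real.summable_nat_rpow.2 (by linarith : -(1 + ε) < -1))
    exact this.congr fun j => by push_cast; rfl
  set c : ℝ := ‖(β : ℂ) - 1‖ * ‖(β : ℂ)‖ * ‖(β : ℂ) + 1‖ * ‖(β : ℂ) + 2‖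
  refine ⟨|β - 1|⁻¹ * (c * ∑' j : ℕ, (j + 1 : ℝ) ^ (-(1 + ε))), ?_, ?_⟩
  · have : 0 ≤ ∑' j : ℕ, (j + 1 : ℝ) ^ (-(1 + ε)) := tsum_nonneg fun j => by positivity
    positivity
  intro n hn
  obtain ⟨N, rfl⟩ : ∃ N, n = N + 1 := ⟨n - 1, by omega⟩
  have hS : (β - 1) * (S (N + 1) β - (((N + 1 : ℕ) : ℝ) ^ (1 - β) / (1 - β)
      - ((N + 1 : ℕ) : ℝ) ^ (-β) / 2 - β / 12 * ((N + 1 : ℕ) : ℝ) ^ (-β - 1)))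
      = -(riemannZeta₁ β - zetaEM N β).re := by
    have hz : (riemannZeta₁ β).re = (β - 1) * zr β := by
      have : riemannZeta₁ β = ((β - 1 : ℝ) : ℂ) * riemannZeta β := by
        rw [riemannZeta_eq_inv_sub_mul hβ1']
        have := sub_ne_zero.2 hβ1'
        push_cast
        field_simp
      rw [this, Complex.re_ofReal_mul, zr]
    have hre : ∀ (k : ℕ) (r : ℝ), ((k + 1 : ℝ) : ℂ) ^ (r : ℂ) = (((k + 1 : ℝ) ^ r : ℝ) : ℂ) :=
      fun k r => (Complex.ofReal_cpow (by positivity) r).symm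
    have hE : zetaEM N β = (((β - 1) * (∑ k ∈ Finset.range N, (k + 1 : ℝ) ^ (-β)
        + (N + 1 : ℝ) ^ (-β) / 2 + β / 12 * (N + 1 : ℝ) ^ (-β - 1)) + (N + 1 : ℝ) ^ (1 - β) : ℝ)
        : ℂ) := by
      have h1 := fun k => hre k (-β)
      have h2 := hre N (-β - 1)
      have h3 := hre N (1 - β)
      simp only [Complex.ofReal_neg, Complex.ofReal_sub, Complex.ofReal_one] at h1 h2 h3
      simp only [zetaEM, h1, h2, h3]
      push_cast
      ring
    have hI : ∑ k ∈ Finset.Icc 1 N, (k : ℝ) ^ (-β) = ∑ k ∈ Finset.range N, (k + 1 : ℝ) ^ (-β) := by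
      rw [Finset.range_eq_Ico, ← Finset.Ico_add_one_right_eq_Icc,
        Finset.sum_Ico_eq_sum_range, Finset.range_eq_Ico]
      simp [add_comm]
    rw [Complex.sub_re, hz, hE, Complex.ofReal_re, S, Nat.add_sub_cancel, hI]
    have : 1 - β ≠ 0 := sub_ne_zero.2 hβ1.symm
    push_cast
    field_simp
    ring
  have hz : ‖riemannZeta₁ β - zetaEM N β‖
      ≤ c * (∑' j : ℕ, (j + 1 : ℝ) ^ (-(1 + ε))) * (N + 1 : ℝ) ^ (-β - 2 + ε) := by
    have hs := hasSum_zetaEM_sub N (s := β) (by simpa using hβ)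
    refine hs.norm_le_of_bounded ((hsum.hasSum.mul_left c).mul_right _) fun j => ?_
    refine (norm_zetaEM_succ_sub_le (N + j) (by simp; linarith)).trans ?_
    rw [mul_assoc c]
    refine mul_le_mul_of_nonneg_left ?_ (by positivity)
    have e : -(β : ℂ).re - 3 = -(1 + ε) + (-β - 2 + ε) := by simp; ring
    have h1 : (0 : ℝ) ≤ N := Nat.cast_nonneg _
    have h2 : (0 : ℝ) ≤ j := Nat.cast_nonneg _
    rw [e, Real.rpow_add (by positivity)]
    refine mul_le_mul ?_ ?_ (by positivity) (by positivity)
    · exact Real.rpow_le_rpow_of_nonpos (by positivity) (by push_cast; linarith) (by linarith)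
    · exact Real.rpow_le_rpow_of_nonpos (by positivity) (by push_cast; linarith) (by linarith)
  have h := (Complex.abs_re_le_norm _).trans hz
  rw [← abs_neg, ← hS, abs_mul] at h
  have hp : 0 < |β - 1| := abs_pos.2 hβ0
  refine ((le_div_iff₀' hp).2 h).trans_eq ?_
  push_cast
  ring

theorem exists_endpoint_coeff_bound {α : ℝ} (hα0 : 0 < α) (hα1 : α < 1) :
    ∃ C : ℝ, 0 ≤ C ∧ ∀ n : ℕ, 1 ≤ n →
      |S n (α + 1) + (n : ℝ) ^ (-α) * (1 / α + 1 / (2 * n) + (1 + α) / (12 * n ^ 2))|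
        ≤ C / n ^ 3 ∧
      |K1 n α + (n : ℝ) ^ (-α) / (12 * n)| ≤ C / n ^ 2 ∧ |K2 n α| ≤ C / n := by
  obtain ⟨C₀, hC₀, h₀⟩ := exists_abs_S_sub_le (β := α + 1) (ε := α) (by linarith) (by linarith)
    hα0 (by linarith)
  obtain ⟨C₁, hC₁, h₁⟩ := exists_abs_S_sub_le (β := α) (ε := α) (by linarith) (by linarith)
    hα0 (by linarith)
  obtain ⟨C₂, hC₂, h₂⟩ := exists_abs_S_sub_le (β := α - 1) (ε := α) (by linarith) (by linarith)
    hα0 (by linarith)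
  refine ⟨C₀ + C₁ + C₂, by positivity, fun n hn => ?_⟩
  specialize h₀ n hn
  specialize h₁ n hn
  specialize h₂ n hn
  have hn0 : (0 : ℝ) < n := by exact_mod_cast hn
  have hpow : ∀ (m : ℤ) (p : ℝ), p = m - α → (n : ℝ) ^ p = (n : ℝ) ^ m * (n : ℝ) ^ (-α) := by
    rintro m p rfl
    rw [sub_eq_add_neg, Real.rpow_add hn0, Real.rpow_intCast]
  have hint : ∀ (m : ℤ) (p : ℝ), p = m → (n : ℝ) ^ p = (n : ℝ) ^ m := by
    rintro m p rfl
    exact Real.rpow_intCast _ _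
  rw [hpow 0 (1 - (α + 1)) (by push_cast; ring), hpow (-1) (-(α + 1)) (by push_cast; ring),
    hpow (-2) (-(α + 1) - 1) (by push_cast; ring),
    hint (-3) (-(α + 1) - 2 + α) (by push_cast; ring)] at h₀
  rw [hpow 1 (1 - α) (by push_cast; ring), hpow (-1) (-α - 1) (by push_cast; ring),
    hint (-2) (-α - 2 + α) (by push_cast; ring)] at h₁
  rw [hpow 2 (1 - (α - 1)) (by push_cast; ring), hpow 1 (-(α - 1)) (by push_cast; ring),
    hpow 0 (-(α - 1) - 1) (by push_cast; ring),
    hint (-1) (-(α - 1) - 2 + α) (by push_cast; ring)] at h₂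
  rw [K1, K2, hpow 1 (1 - α) (by push_cast; ring), hpow 2 (2 - α) (by push_cast; ring)]
  have z2 : (n : ℝ) ^ (-2 : ℤ) = 1 / n ^ 2 := by rw [zpow_neg, one_div]; rfl
  have z3 : (n : ℝ) ^ (-3 : ℤ) = 1 / n ^ 3 := by rw [zpow_neg, one_div]; rfl
  have z2' : (n : ℝ) ^ (2 : ℤ) = n ^ 2 := rfl
  simp only [z2, z3, z2', zpow_zero, zpow_one, zpow_neg_one] at h₀ h₁ h₂ ⊢
  set A := (n : ℝ) ^ (-α)
  set e₀ := S n (α + 1) - (1 * A / (1 - (α + 1)) - (n : ℝ)⁻¹ * A / 2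
    - (α + 1) / 12 * (1 / n ^ 2 * A)) with he₀
  set e₁ := S n α - (n * A / (1 - α) - A / 2 - α / 12 * ((n : ℝ)⁻¹ * A)) with he₁
  set e₂ := S n (α - 1) - (n ^ 2 * A / (1 - (α - 1)) - n * A / 2 - (α - 1) / 12 * (1 * A)) with he₂
  have hα : 1 - α ≠ 0 := by linarith
  have hα' : α - 1 ≠ 0 := by linarith
  have hα'' : α - 2 ≠ 0 := by linarith
  have hα₂ : 2 - α ≠ 0 := by linarith
  refine ⟨?_, ?_, ?_⟩
  · have : S n (α + 1) + A * (1 / α + 1 / (2 * n) + (1 + α) / (12 * n ^ 2)) = e₀ := by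
      rw [he₀, show 1 - (α + 1) = -α by ring]
      field_simp
      ring
    rw [this]
    refine h₀.trans ?_
    rw [mul_one_div]
    gcongr
    linarith
  · have : n * S n (α + 1) - S n α + n * A / (α * (1 - α)) + A / (12 * n) = n * e₀ - e₁ := by
      rw [he₀, he₁, show 1 - (α + 1) = -α by ring]
      field_simp
      ring
    rw [this]
    refine (abs_sub _ _).trans ?_
    rw [abs_mul, abs_of_pos hn0]
    calc n * |e₀| + |e₁| ≤ n * (C₀ * (1 / n ^ 3)) + C₁ * (1 / n ^ 2) := by gcongr
      _ = (C₀ + C₁) / n ^ 2 := by field_simp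
      _ ≤ (C₀ + C₁ + C₂) / n ^ 2 :=
        div_le_div_of_nonneg_right (by linarith) (by positivity)
  · have : (n : ℝ) ^ 2 / 2 * S n (α + 1) - n * S n α + 1 / 2 * S n (α - 1)
        + n ^ 2 * A / (α * (α - 1) * (α - 2)) = n ^ 2 / 2 * e₀ - n * e₁ + 1 / 2 * e₂ := by
      rw [he₀, he₁, he₂, show 1 - (α + 1) = -α by ring, show 1 - (α - 1) = -(α - 2) by ring,
        show 1 - α = -(α - 1) by ring]
      field_simp
      ring
    rw [this]
    refine (abs_add_le _ _).trans ((add_le_add_left (abs_sub _ _) _).trans ?_)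
    rw [abs_mul, abs_mul, abs_mul, abs_of_pos hn0, abs_of_pos (by positivity : (0:ℝ) < n ^ 2 / 2),
      abs_of_pos (by norm_num : (0 : ℝ) < 1 / 2)]
    calc n ^ 2 / 2 * |e₀| + n * |e₁| + 1 / 2 * |e₂|
        ≤ n ^ 2 / 2 * (C₀ * (1 / n ^ 3)) + n * (C₁ * (1 / n ^ 2)) + 1 / 2 * (C₂ * (n : ℝ)⁻¹) := by
          gcongr
      _ = (C₀ / 2 + C₁ + C₂ / 2) / n := by field_simp
      _ ≤ (C₀ + C₁ + C₂) / n := div_le_div_of_nonneg_right (by linarith) hn0.le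

theorem Icc_one_sub_one_eq_Ico (n : ℕ) (hn : 1 ≤ n) : Finset.Icc 1 (n - 1) = Finset.Ico 1 n := by
  ext k
  simp only [Finset.mem_Icc, Finset.mem_Ico]
  omega

/-- Composite trapezoidal rule with endpoint-derivative correction, on a grid omitting `0`. -/
theorem abs_composite_corrected_trapezoid_le {F f f₁ f₂ f₃ : ℝ → ℝ} {h : ℝ} (hh : 0 < h)
    {M : ℕ → ℝ} {n : ℕ} (hn : 1 ≤ n)
    (hF : ∀ t ∈ Icc h (n * h), HasDerivAt F (f t) t)
    (hf : ∀ t ∈ Icc h (n * h), HasDerivAt f (f₁ t) t)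
    (hf₁ : ∀ t ∈ Icc h (n * h), HasDerivAt f₁ (f₂ t) t)
    (hf₂ : ∀ t ∈ Icc h (n * h), HasDerivAt f₂ (f₃ t) t)
    (hM : ∀ k ∈ Finset.Ico 1 n, ∀ t ∈ Icc (k * h) ((k + 1) * h), |f₃ t| ≤ M k) :
    |F (n * h) - F h - h * ∑ k ∈ Finset.Ico 1 n, f (k * h) + h / 2 * (f h - f (n * h))
      + h ^ 2 / 12 * (f₁ (n * h) - f₁ h)| ≤ ∑ k ∈ Finset.Ico 1 n, M k * h ^ 4 := by
  have hterm : ∀ k ∈ Finset.Ico 1 n, |F ((k + 1 : ℕ) * h) - F (k * h)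
      - h / 2 * (f (k * h) + f ((k + 1 : ℕ) * h))
      + h ^ 2 / 12 * (f₁ ((k + 1 : ℕ) * h) - f₁ (k * h))| ≤ M k * h ^ 4 := by
    intro k hk
    have hk' := Finset.mem_Ico.1 hk
    have h1 : (1 : ℝ) ≤ k := by exact_mod_cast hk'.1
    have h2 : (k + 1 : ℝ) ≤ n := by exact_mod_cast hk'.2
    have hsub : Icc (k * h) ((k + 1) * h) ⊆ Icc h (n * h) :=
      Icc_subset_Icc (by nlinarith) (by nlinarith)
    have key := norm_corrected_trapezoid_le (a := k * h) (b := (k + 1) * h) (by nlinarith)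
      (fun t ht => hF t (hsub ht)) (fun t ht => hf t (hsub ht)) (fun t ht => hf₁ t (hsub ht))
      (fun t ht => hf₂ t (hsub ht)) (hM k hk)
    rw [show (k + 1) * h - k * h = h by ring] at key
    simpa using key
  have hsum : ∀ m : ℕ, 1 ≤ m → F (m * h) - F h - h * ∑ k ∈ Finset.Ico 1 m, f (k * h)
      + h / 2 * (f h - f (m * h)) + h ^ 2 / 12 * (f₁ (m * h) - f₁ h)
      = ∑ k ∈ Finset.Ico 1 m, (F ((k + 1 : ℕ) * h) - F (k * h)
      - h / 2 * (f (k * h) + f ((k + 1 : ℕ) * h))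
      + h ^ 2 / 12 * (f₁ ((k + 1 : ℕ) * h) - f₁ (k * h))) := by
    intro m hm
    induction m, hm using Nat.le_induction with
    | base => simp
    | succ m hm ih =>
      rw [Finset.sum_Ico_succ_top hm, Finset.sum_Ico_succ_top hm, ← ih]
      ring
  rw [hsum n hn]
  exact (Finset.abs_sum_le_sum_abs _ _).trans (Finset.sum_le_sum hterm)

/-- `R` vanishes to third order at `0`, with derivatives `R₁`, `R₂`, `R₃` and `|R₃| ≤ M` on
`[0, x]`. -/
structure CubicRemainder (R R₁ R₂ R₃ : ℝ → ℝ) (x M : ℝ) : Prop where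
  deriv₀ : ∀ t, HasDerivAt R (R₁ t) t
  deriv₁ : ∀ t, HasDerivAt R₁ (R₂ t) t
  deriv₂ : ∀ t, HasDerivAt R₂ (R₃ t) t
  zero₀ : R 0 = 0
  zero₁ : R₁ 0 = 0
  zero₂ : R₂ 0 = 0
  bound₃ : ∀ t ∈ Icc 0 x, |R₃ t| ≤ M

namespace CubicRemainder

variable {R R₁ R₂ R₃ : ℝ → ℝ} {x M : ℝ}

theorem bound₂ (H : CubicRemainder R R₁ R₂ R₃ x M) : ∀ t ∈ Icc 0 x, |R₂ t| ≤ M * t := by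
  intro t ht
  have := norm_le_of_hasDerivAt_of_eq_zero (a := 0) (b := t) (M := M) (fun u _ => H.deriv₂ u)
    (fun u hu => H.bound₃ u ⟨hu.1, hu.2.trans ht.2⟩) H.zero₂ t ⟨ht.1, le_rfl⟩
  simpa using this

theorem nonneg (H : CubicRemainder R R₁ R₂ R₃ x M) (hx : 0 ≤ x) : 0 ≤ M :=
  (abs_nonneg _).trans (H.bound₃ 0 ⟨le_rfl, hx⟩)

theorem bound₁ (H : CubicRemainder R R₁ R₂ R₃ x M) : ∀ t ∈ Icc 0 x, |R₁ t| ≤ M * t ^ 2 := by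
  intro t ht
  have hM := H.nonneg (ht.1.trans ht.2)
  have := norm_le_of_hasDerivAt_of_eq_zero (a := 0) (b := t) (M := M * t) (fun u _ => H.deriv₁ u)
    (fun u hu => (H.bound₂ u ⟨hu.1, hu.2.trans ht.2⟩).trans (by gcongr; exact hu.2))
    H.zero₁ t ⟨ht.1, le_rfl⟩
  refine this.trans_eq (by ring)

theorem bound₀ (H : CubicRemainder R R₁ R₂ R₃ x M) : ∀ t ∈ Icc 0 x, |R t| ≤ M * t ^ 3 := by
  intro t ht
  have hM := H.nonneg (ht.1.trans ht.2)
  have := norm_le_of_hasDerivAt_of_eq_zero (a := 0) (b := t) (M := M * t ^ 2)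
    (fun u _ => H.deriv₀ u)
    (fun u hu => (H.bound₁ u ⟨hu.1, hu.2.trans ht.2⟩).trans
      (by have := hu.1; have := hu.2; gcongr))
    H.zero₀ t ⟨ht.1, le_rfl⟩
  refine this.trans_eq (by ring)

/-- First-order Taylor bound at the right end of the interval. -/
theorem abs_sub_add_le (H : CubicRemainder R R₁ R₂ R₃ x M) {d : ℝ} (hd : 0 ≤ d) (hdx : d ≤ x) :
    |R (x - d) - R x + d * R₁ x| ≤ M * x * d ^ 2 := by
  have hM := H.nonneg (hd.trans hdx)
  have h1 : ∀ u ∈ Icc 0 d, ‖R₁ x - R₁ (x - u)‖ ≤ M * x * (d - 0) := by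
    refine norm_le_of_hasDerivAt_of_eq_zero (f' := fun u => R₂ (x - u)) ?_ ?_ (by simp)
    · intro u _
      refine (((H.deriv₁ (x - u)).comp u ((hasDerivAt_id u).const_sub x)).const_sub
        (R₁ x)).congr_deriv ?_
      ring
    · intro u hu
      have := hu.1
      have := hu.2
      refine (H.bound₂ _ ⟨by linarith, by linarith⟩).trans ?_
      gcongr
      linarith
  have := norm_le_of_hasDerivAt_of_eq_zero (f := fun u => R (x - u) - R x + u * R₁ x)
    (f' := fun u => R₁ x - R₁ (x - u)) (a := 0) (b := d) ?_ h1 (by simp) d ⟨hd, le_rfl⟩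
  · refine this.trans_eq (by ring)
  · intro u _
    refine ((((H.deriv₀ (x - u)).comp u ((hasDerivAt_id u).const_sub x)).sub_const _).add
      ((hasDerivAt_id u).mul_const (R₁ x))).congr_deriv ?_
    ring

theorem intervalIntegrable (H : CubicRemainder R R₁ R₂ R₃ x M) {α : ℝ} (hα1 : α < 1) (a b : ℝ) :
    IntervalIntegrable (fun s => R₁ s * s ^ (-α)) volume a b :=
  (intervalIntegral.intervalIntegrable_rpow' (by linarith)).continuousOn_mul
    (fun t _ => (H.deriv₁ t).continuousAt.continuousWithinAt)

theorem abs_integral_le (H : CubicRemainder R R₁ R₂ R₃ x M) {α : ℝ} (hα1 : α < 1)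
    {t : ℝ} (ht : 0 < t) (htx : t ≤ x) :
    |∫ s in (0 : ℝ)..t, R₁ s * s ^ (-α)| ≤ M * t ^ (3 - α) := by
  have hM := H.nonneg (ht.le.trans htx)
  have h := intervalIntegral.norm_integral_le_of_norm_le_const (a := 0) (b := t)
    (f := fun s => R₁ s * s ^ (-α)) (C := M * t ^ (2 - α)) ?_
  · rw [sub_zero, abs_of_pos ht, mul_assoc, ← Real.rpow_add_one ht.ne'] at h
    rwa [show 2 - α + 1 = 3 - α by ring] at h
  · intro s hs
    rw [uIoc_of_le ht.le] at hs
    have h1 := H.bound₁ s ⟨hs.1.le, hs.2.trans htx⟩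
    have h2 : s ^ (2 - α) = s ^ 2 * s ^ (-α) := by
      rw [sub_eq_add_neg, Real.rpow_add hs.1, Real.rpow_two]
    have h3 := Real.rpow_nonneg hs.1.le (-α)
    rw [norm_mul, Real.norm_of_nonneg h3]
    calc ‖R₁ s‖ * s ^ (-α) ≤ M * s ^ 2 * s ^ (-α) := by gcongr; exact h1
      _ = M * s ^ (2 - α) := by rw [h2]; ring
      _ ≤ M * t ^ (2 - α) := by
        gcongr
        · exact hs.1.le
        · linarith
        · exact hs.2

theorem hasDerivAt_antideriv (H : CubicRemainder R R₁ R₂ R₃ x M) {α : ℝ} (hα0 : 0 < α)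
    (hα1 : α < 1) {t : ℝ} (ht : 0 < t) :
    HasDerivAt (fun u => ((∫ s in (0 : ℝ)..u, R₁ s * s ^ (-α)) - u ^ (-α) * R u) / α)
      (t ^ (-1 - α) * R t) t := by
  have hpow := Real.hasDerivAt_rpow_const (x := t) (p := -α) (Or.inl ht.ne')
  have hc : ContinuousAt (fun s => R₁ s * s ^ (-α)) t :=
    (H.deriv₁ t).continuousAt.mul (Real.continuousAt_rpow_const _ _ (Or.inl ht.ne'))
  have hmeas : StronglyMeasurableAtFilter (fun s => R₁ s * s ^ (-α)) (𝓝 t) volume := by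
    have hcR : Continuous R₁ := continuous_iff_continuousAt.2 fun u => (H.deriv₁ u).continuousAt
    exact (hcR.measurable.mul
      (measurable_id.pow_const _)).stronglyMeasurable.stronglyMeasurableAtFilter
  have hG := intervalIntegral.integral_hasDerivAt_right (H.intervalIntegrable hα1 0 t) hmeas hc
  refine ((hG.sub (hpow.mul (H.deriv₀ t))).div_const α).congr_deriv ?_
  rw [show -α - 1 = -1 - α by ring]
  field_simp
  ring

end CubicRemainder

theorem hasDerivAt_mul_rpow {g : ℝ → ℝ} {g' t p q : ℝ} (ht : 0 < t) (hpq : p = q + 1)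
    (hg : HasDerivAt g g' t) :
    HasDerivAt (fun u => u ^ p * g u) (p * t ^ q * g t + t ^ p * g') t := by
  subst hpq
  refine ((Real.hasDerivAt_rpow_const (Or.inl ht.ne')).mul hg).congr_deriv ?_
  simp

namespace CubicRemainder

variable {R R₁ R₂ R₃ : ℝ → ℝ} {x M : ℝ}

theorem exists_abs_bulk_sum_sub_le (H : CubicRemainder R R₁ R₂ R₃ x M) (hx : 0 < x) {α : ℝ}
    (hα0 : 0 < α) (hα1 : α < 1) :
    ∃ C : ℝ, 0 ≤ C ∧ ∀ n : ℕ, 1 ≤ n → ∀ h : ℝ, x = n * h →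
      |h ^ (-α) * (∑ k ∈ Finset.Ico 1 n, (k : ℝ) ^ (-1 - α) * R (k * h)
        + (n : ℝ) ^ (-α) * (1 / α + 1 / (2 * n) + (1 + α) / (12 * n ^ 2)) * R x
        - h * ((n : ℝ) ^ (-α) / (12 * n)) * R₁ x)
        - (∫ s in (0 : ℝ)..x, R₁ s * s ^ (-α)) / α| ≤ C * h ^ (3 - α) := by
  have hM0 := H.nonneg hx.le
  set G : ℝ → ℝ := fun t => ∫ s in (0 : ℝ)..t, R₁ s * s ^ (-α)
  set Z : ℝ := ∑' k : ℕ, (k : ℝ) ^ (-1 - α)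
  have hZs : Summable fun k : ℕ => (k : ℝ) ^ (-1 - α) :=
    Real.summable_nat_rpow.2 (by linarith)
  have hZ0 : 0 ≤ Z := tsum_nonneg fun k => by positivity
  refine ⟨49 * M * Z + 2 * M / α + M / 2 + M / 4, by positivity, fun n hn h hxn => ?_⟩
  have hn0 : (0 : ℝ) < n := by exact_mod_cast hn
  have hn1 : (1 : ℝ) ≤ n := by exact_mod_cast hn
  have hh : 0 < h := by
    have : 0 < n * h := hxn ▸ hx
    exact (pos_iff_pos_of_mul_pos this).1 hn0
  have hhx : h ≤ x := by nlinarith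
  set f : ℝ → ℝ := fun t => t ^ (-1 - α) * R t with hf
  set f₁ : ℝ → ℝ := fun t => (-1 - α) * (t ^ (-2 - α) * R t) + t ^ (-1 - α) * R₁ t with hf₁
  set f₂ : ℝ → ℝ := fun t => (-1 - α) * (-2 - α) * (t ^ (-3 - α) * R t)
    + 2 * (-1 - α) * (t ^ (-2 - α) * R₁ t) + t ^ (-1 - α) * R₂ t with hf₂
  set f₃ : ℝ → ℝ := fun t => (-1 - α) * (-2 - α) * (-3 - α) * (t ^ (-4 - α) * R t)
    + 3 * (-1 - α) * (-2 - α) * (t ^ (-3 - α) * R₁ t)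
    + 3 * (-1 - α) * (t ^ (-2 - α) * R₂ t) + t ^ (-1 - α) * R₃ t with hf₃
  have hmono : ∀ (c p q : ℝ) (m : ℕ) (t r : ℝ), 0 < t → |r| ≤ M * t ^ m → q = p + m →
      |c * (t ^ p * r)| ≤ |c| * (M * t ^ q) := by
    rintro c p q m t r ht hr rfl
    rw [abs_mul, abs_mul, abs_of_nonneg (Real.rpow_nonneg ht.le _), Real.rpow_add ht,
      Real.rpow_natCast]
    refine mul_le_mul_of_nonneg_left ?_ (abs_nonneg c)
    calc t ^ p * |r| ≤ t ^ p * (M * t ^ m) := by gcongr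
      _ = M * (t ^ p * t ^ m) := by ring
  have hf₃b : ∀ t ∈ Icc h x, |f₃ t| ≤ 49 * M * t ^ (-1 - α) := by
    intro t ht
    have ht0 : 0 < t := hh.trans_le ht.1
    have htx : t ∈ Icc 0 x := ⟨ht0.le, ht.2⟩
    have b0 := hmono ((-1 - α) * (-2 - α) * (-3 - α)) (-4 - α) (-1 - α) 3 t _ ht0
      (H.bound₀ t htx) (by push_cast; ring)
    have b1 := hmono (3 * (-1 - α) * (-2 - α)) (-3 - α) (-1 - α) 2 t _ ht0
      (H.bound₁ t htx) (by push_cast; ring)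
    have b2 := hmono (3 * (-1 - α)) (-2 - α) (-1 - α) 1 t _ ht0
      (by simpa using H.bound₂ t htx) (by push_cast; ring)
    have b3 := hmono 1 (-1 - α) (-1 - α) 0 t _ ht0
      (by simpa using H.bound₃ t htx) (by push_cast; ring)
    rw [one_mul] at b3
    set T := M * t ^ (-1 - α)
    have hT : 0 ≤ T := by positivity
    have c0 : |(-1 - α) * (-2 - α) * (-3 - α)| ≤ 24 := by
      rw [show (-1 - α) * (-2 - α) * (-3 - α) = -((1 + α) * (2 + α) * (3 + α)) by ring, abs_neg,
        abs_of_nonneg (by positivity)]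
      calc (1 + α) * (2 + α) * (3 + α) ≤ (1 + 1) * (2 + 1) * (3 + 1) := by gcongr
        _ = 24 := by norm_num
    have c1 : |3 * (-1 - α) * (-2 - α)| ≤ 18 := by
      rw [show 3 * (-1 - α) * (-2 - α) = 3 * (1 + α) * (2 + α) by ring,
        abs_of_nonneg (by positivity)]
      calc 3 * (1 + α) * (2 + α) ≤ 3 * (1 + 1) * (2 + 1) := by gcongr
        _ = 18 := by norm_num
    have c2 : |3 * (-1 - α)| ≤ 6 := by
      rw [show 3 * (-1 - α) = -(3 * (1 + α)) by ring, abs_neg, abs_of_nonneg (by positivity)]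
      linarith
    rw [abs_one] at b3
    calc |f₃ t| ≤ 24 * T + 18 * T + 6 * T + 1 * T := by
          refine (abs_add_le _ _).trans (add_le_add ((abs_add_le _ _).trans (add_le_add
            ((abs_add_le _ _).trans (add_le_add ?_ ?_)) ?_)) b3)
          · exact b0.trans (by gcongr)
          · exact b1.trans (by gcongr)
          · exact b2.trans (by gcongr)
      _ = 49 * M * t ^ (-1 - α) := by simp only [T]; ring
  have hpos : ∀ t ∈ Icc h (n * h), 0 < t := fun t ht => hh.trans_le ht.1
  have key := abs_composite_corrected_trapezoid_le (f := f) (f₁ := f₁) (f₂ := f₂) (f₃ := f₃)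
    (F := fun u => (G u - u ^ (-α) * R u) / α) (M := fun k => 49 * M * (k * h) ^ (-1 - α)) hh hn
    (fun t ht => H.hasDerivAt_antideriv hα0 hα1 (hpos t ht)) ?_ ?_ ?_ ?_
  · set F : ℝ → ℝ := fun u => (G u - u ^ (-α) * R u) / α with hFdef
    have hpowh : ∀ p : ℝ, 0 < h ^ p := fun p => Real.rpow_pos_of_pos hh p
    have hhm : h ∈ Icc 0 x := ⟨hh.le, hhx⟩
    have e1 : ∑ k ∈ Finset.Ico 1 n, 49 * M * (k * h) ^ (-1 - α) * h ^ 4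
        ≤ 49 * M * Z * h ^ (3 - α) := by
      have hle : ∑ k ∈ Finset.Ico 1 n, (k : ℝ) ^ (-1 - α) ≤ Z :=
        hZs.sum_le_tsum _ fun k _ => by positivity
      have e : h ^ (3 - α) = h ^ (-1 - α) * h ^ 4 := by
        rw [← Real.rpow_natCast h 4, ← Real.rpow_add hh]
        congr 1
        push_cast
        ring
      calc ∑ k ∈ Finset.Ico 1 n, 49 * M * (k * h) ^ (-1 - α) * h ^ 4
          = 49 * M * (∑ k ∈ Finset.Ico 1 n, (k : ℝ) ^ (-1 - α)) * h ^ (3 - α) := by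
            rw [Finset.mul_sum, Finset.sum_mul]
            refine Finset.sum_congr rfl fun k _ => ?_
            rw [Real.mul_rpow (Nat.cast_nonneg _) hh.le, e]
            ring
        _ ≤ _ := by gcongr
    have e2 : |F h| ≤ 2 * M / α * h ^ (3 - α) := by
      have h1 := H.abs_integral_le hα1 hh hhx
      have h2 := hmono 1 (-α) (3 - α) 3 h _ hh (H.bound₀ h hhm) (by push_cast; ring)
      rw [one_mul, abs_one, one_mul] at h2
      have h3 : |G h - h ^ (-α) * R h| ≤ M * h ^ (3 - α) + M * h ^ (3 - α) :=
        (abs_sub _ _).trans (add_le_add h1 h2)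
      rw [hFdef, abs_div, abs_of_pos hα0]
      calc _ ≤ (M * h ^ (3 - α) + M * h ^ (3 - α)) / α := by gcongr
        _ = _ := by ring
    have e3 : |h / 2 * f h| ≤ M / 2 * h ^ (3 - α) := by
      have h2 := hmono 1 (-1 - α) (2 - α) 3 h _ hh (H.bound₀ h hhm) (by push_cast; ring)
      rw [one_mul, abs_one, one_mul] at h2
      have e : h ^ (3 - α) = h ^ (2 - α) * h := by
        rw [← Real.rpow_add_one hh.ne']
        congr 1
        ring
      rw [abs_mul, abs_of_pos (by positivity), e]
      calc h / 2 * |f h| ≤ h / 2 * (M * h ^ (2 - α)) := by gcongr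
        _ = _ := by ring
    have e4 : |h ^ 2 / 12 * f₁ h| ≤ M / 4 * h ^ (3 - α) := by
      have h2 := hmono (-1 - α) (-2 - α) (1 - α) 3 h _ hh (H.bound₀ h hhm) (by push_cast; ring)
      have h3 := hmono 1 (-1 - α) (1 - α) 2 h _ hh (H.bound₁ h hhm) (by push_cast; ring)
      rw [one_mul, abs_one, one_mul] at h3
      have hc : |-1 - α| ≤ 2 := by
        rw [abs_le]
        constructor <;> linarith
      have e : h ^ (3 - α) = h ^ (1 - α) * h ^ 2 := by
        rw [← Real.rpow_natCast h 2, ← Real.rpow_add hh]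
        congr 1
        push_cast
        ring
      have h4 : |f₁ h| ≤ 2 * (M * h ^ (1 - α)) + M * h ^ (1 - α) :=
        (abs_add_le _ _).trans (add_le_add (h2.trans (by gcongr)) h3)
      rw [abs_mul, abs_of_pos (by positivity), e]
      calc h ^ 2 / 12 * |f₁ h| ≤ h ^ 2 / 12 * (2 * (M * h ^ (1 - α)) + M * h ^ (1 - α)) := by
            gcongr
        _ = _ := by ring
    have hbulk : h ^ (-α) * ∑ k ∈ Finset.Ico 1 n, (k : ℝ) ^ (-1 - α) * R (k * h)
        = h * ∑ k ∈ Finset.Ico 1 n, f (k * h) := by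
      rw [Finset.mul_sum, Finset.mul_sum]
      refine Finset.sum_congr rfl fun k _ => ?_
      have e : h ^ (-α) = h ^ (-1 - α) * h := by
        rw [← Real.rpow_add_one hh.ne']
        congr 1
        ring
      rw [hf]
      simp only
      rw [Real.mul_rpow (Nat.cast_nonneg _) hh.le, e]
      ring
    have hxp : x ^ (-α) = (n : ℝ) ^ (-α) * h ^ (-α) := by
      rw [hxn, Real.mul_rpow hn0.le hh.le]
    have hx1 : x ^ (-1 - α) = x ^ (-α) / x := by
      rw [← Real.rpow_sub_one hx.ne']
      congr 1
      ring
    have hx2 : x ^ (-2 - α) = x ^ (-α) / x ^ 2 := by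
      rw [← Real.rpow_sub_natCast hx.ne']
      congr 1
      push_cast
      ring
    have hid : h ^ (-α) * (∑ k ∈ Finset.Ico 1 n, (k : ℝ) ^ (-1 - α) * R (k * h)
        + (n : ℝ) ^ (-α) * (1 / α + 1 / (2 * n) + (1 + α) / (12 * n ^ 2)) * R x
        - h * ((n : ℝ) ^ (-α) / (12 * n)) * R₁ x) - G x / α
        = -(F x - F h - h * ∑ k ∈ Finset.Ico 1 n, f (k * h) + h / 2 * (f h - f x)
          + h ^ 2 / 12 * (f₁ x - f₁ h)) - F h + h / 2 * f h - h ^ 2 / 12 * f₁ h := by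
      rw [mul_sub, mul_add, hbulk]
      have hfx : f x = x ^ (-α) / x * R x := by rw [hf, ← hx1]
      have hf₁x : f₁ x = (-1 - α) * (x ^ (-α) / x ^ 2 * R x) + x ^ (-α) / x * R₁ x := by
        rw [hf₁, ← hx1, ← hx2]
      have hFx : F x = (G x - x ^ (-α) * R x) / α := rfl
      rw [hfx, hf₁x, hFx, hxp]
      have hhn : h = x / n := by rw [hxn]; field_simp
      generalize h ^ (-α) = P
      generalize (n : ℝ) ^ (-α) = A
      generalize G x = g
      generalize R x = r
      generalize R₁ x = r₁
      generalize f h = u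
      generalize f₁ h = u₁
      generalize F h = v
      generalize ∑ k ∈ Finset.Ico 1 n, f (k * h) = w
      rw [hhn]
      field_simp
      ring
    rw [← hxn] at key
    rw [hid]
    set D := F x - F h - h * ∑ k ∈ Finset.Ico 1 n, f (k * h) + h / 2 * (f h - f x)
          + h ^ 2 / 12 * (f₁ x - f₁ h)
    calc |-D - F h + h / 2 * f h - h ^ 2 / 12 * f₁ h|
        ≤ |D| + |F h| + |h / 2 * f h| + |h ^ 2 / 12 * f₁ h| := by
          refine (abs_sub _ _).trans (add_le_add_left ((abs_add_le _ _).trans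
            (add_le_add_left ((abs_sub _ _).trans ?_) _)) _)
          rw [abs_neg]
      _ ≤ 49 * M * Z * h ^ (3 - α) + 2 * M / α * h ^ (3 - α) + M / 2 * h ^ (3 - α)
          + M / 4 * h ^ (3 - α) := by
          gcongr
          exact key.trans e1
      _ = _ := by ring
  · intro t ht
    refine (hasDerivAt_mul_rpow (q := -2 - α) (hpos t ht) (by ring) (H.deriv₀ t)).congr_deriv ?_
    simp only [hf₁]
    ring
  · intro t ht
    refine (((hasDerivAt_mul_rpow (q := -3 - α) (hpos t ht) (by ring) (H.deriv₀ t)).const_mul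
      (-1 - α)).add
      (hasDerivAt_mul_rpow (q := -2 - α) (hpos t ht) (by ring) (H.deriv₁ t))).congr_deriv ?_
    simp only [hf₂]
    ring
  · intro t ht
    refine ((((hasDerivAt_mul_rpow (q := -4 - α) (hpos t ht) (by ring) (H.deriv₀ t)).const_mul
      ((-1 - α) * (-2 - α))).add
      ((hasDerivAt_mul_rpow (q := -3 - α) (hpos t ht) (by ring) (H.deriv₁ t)).const_mul
        (2 * (-1 - α)))).add
      (hasDerivAt_mul_rpow (q := -2 - α) (hpos t ht) (by ring) (H.deriv₂ t))).congr_deriv ?_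
    simp only [hf₃]
    ring
  · intro k hk t ht
    have hk' := Finset.mem_Ico.1 hk
    have h1 : (1 : ℝ) ≤ k := by exact_mod_cast hk'.1
    have h2 : (k + 1 : ℝ) ≤ n := by exact_mod_cast hk'.2
    have ht1 : h ≤ t := le_trans (by nlinarith) ht.1
    refine (hf₃b t ⟨ht1, ht.2.trans (by rw [hxn]; gcongr)⟩).trans ?_
    refine mul_le_mul_of_nonneg_left ?_ (by positivity)
    exact Real.rpow_le_rpow_of_nonpos (by positivity) ht.1 (by linarith)

end CubicRemainder

/-- The quadrature sum `∑ δ_k z (k h)` with the corrected weights `δ_k`. -/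
noncomputable def correctedSum (α : ℝ) (n : ℕ) (h : ℝ) (z : ℝ → ℝ) : ℝ :=
  (-zr (1 + α) + (3 / 2) * zr α - (1 / 2) * zr (α - 1)) * z 0
    + (1 - 2 * zr α + zr (α - 1)) * z h
    + ((2 : ℝ) ^ (-1 - α) + (1 / 2) * zr α - (1 / 2) * zr (α - 1)) * z (2 * h)
    + (∑ k ∈ Finset.Icc 3 (n - 3), (k : ℝ) ^ (-1 - α) * z (k * h))
    + (((n : ℝ) - 2) ^ (-1 - α) + (1 / 2) * K1 n α - K2 n α) * z ((n - 2) * h)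
    + (((n : ℝ) - 1) ^ (-1 - α) - 2 * K1 n α + 2 * K2 n α) * z ((n - 1) * h)
    + ((zr (1 + α) - ∑ k ∈ Finset.Icc 1 (n - 1), (k : ℝ) ^ (-1 - α))
        + (3 / 2) * K1 n α - K2 n α) * z (n * h)

theorem S_add_one_eq (n : ℕ) (α : ℝ) :
    S n (α + 1) = ∑ k ∈ Finset.Icc 1 (n - 1), (k : ℝ) ^ (-1 - α) - zr (1 + α) := by
  rw [S, add_comm α 1, neg_add']

theorem correctedSum_eq (α : ℝ) {n : ℕ} (hn : 6 ≤ n) (h : ℝ) (z : ℝ → ℝ) :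
    correctedSum α n h z = ∑ k ∈ Finset.Icc 1 (n - 1), (k : ℝ) ^ (-1 - α) * z (k * h)
      - zr (1 + α) * z 0 + zr α * (3 / 2 * z 0 - 2 * z h + 1 / 2 * z (2 * h))
      - zr (α - 1) * (1 / 2 * z 0 - z h + 1 / 2 * z (2 * h)) - S n (α + 1) * z (n * h)
      + K1 n α * (1 / 2 * z ((n - 2) * h) - 2 * z ((n - 1) * h) + 3 / 2 * z (n * h))
      - K2 n α * (z ((n - 2) * h) - 2 * z ((n - 1) * h) + z (n * h)) := by
  have hsplit : ∑ k ∈ Finset.Icc 1 (n - 1), (k : ℝ) ^ (-1 - α) * z (k * h)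
      = z h + (2 : ℝ) ^ (-1 - α) * z (2 * h)
        + (∑ k ∈ Finset.Icc 3 (n - 3), (k : ℝ) ^ (-1 - α) * z (k * h))
        + ((n : ℝ) - 2) ^ (-1 - α) * z ((n - 2) * h)
        + ((n : ℝ) - 1) ^ (-1 - α) * z ((n - 1) * h) := by
    obtain ⟨m, rfl⟩ := Nat.exists_eq_add_of_le' hn
    have h1 : Finset.Icc 1 (m + 6 - 1) = Finset.Ico 1 (m + 4 + 1 + 1) := by
      ext
      simp only [Finset.mem_Icc, Finset.mem_Ico]
      omega
    have h2 : Finset.Icc 3 (m + 6 - 3) = Finset.Ico 3 (m + 4) := by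
      ext
      simp only [Finset.mem_Icc, Finset.mem_Ico]
      omega
    rw [h1, h2, Finset.sum_Ico_succ_top (by omega), Finset.sum_Ico_succ_top (by omega),
      Finset.sum_eq_sum_Ico_succ_bot (by omega), Finset.sum_eq_sum_Ico_succ_bot (by omega)]
    push_cast
    rw [show (m : ℝ) + 6 - 2 = m + 4 by ring, show (m : ℝ) + 6 - 1 = m + 5 by ring,
      Real.one_rpow, one_mul, one_mul]
    ring
  rw [hsplit, S_add_one_eq, correctedSum]
  ring

/-- On a quadratic polynomial the rule gives exactly `h ^ α * Γ (-α)` times the Caputo derivative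
at `x = n h`. -/
theorem correctedSum_quadratic_add {α : ℝ} (hα0 : 0 < α) (hα1 : α < 1) {n : ℕ} (hn : 6 ≤ n)
    (h c₀ c₁ c₂ : ℝ) (R : ℝ → ℝ) :
    correctedSum α n h (fun t => c₀ + c₁ * t + c₂ * t ^ 2 + R t)
      = c₁ * h * n ^ (1 - α) / (α * (1 - α)) + 2 * c₂ * h ^ 2 * n ^ (2 - α) / (α * (2 - α))
        + correctedSum α n h R := by
  have hn0 : (0 : ℝ) < n := by exact_mod_cast (by omega : 0 < n)
  set A₀ := ∑ k ∈ Finset.Icc 1 (n - 1), (k : ℝ) ^ (-1 - α) with hA₀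
  set A₁ := ∑ k ∈ Finset.Icc 1 (n - 1), (k : ℝ) ^ (-α) with hA₁
  set A₂ := ∑ k ∈ Finset.Icc 1 (n - 1), (k : ℝ) ^ (-(α - 1)) with hA₂
  have hsum : ∑ k ∈ Finset.Icc 1 (n - 1),
      (k : ℝ) ^ (-1 - α) * (c₀ + c₁ * (k * h) + c₂ * (k * h) ^ 2 + R (k * h))
      = c₀ * A₀ + c₁ * h * A₁ + c₂ * h ^ 2 * A₂
        + ∑ k ∈ Finset.Icc 1 (n - 1), (k : ℝ) ^ (-1 - α) * R (k * h) := by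
    rw [hA₀, hA₁, hA₂, Finset.mul_sum, Finset.mul_sum, Finset.mul_sum, ← Finset.sum_add_distrib,
      ← Finset.sum_add_distrib, ← Finset.sum_add_distrib]
    refine Finset.sum_congr rfl fun k hk => ?_
    have hk0 : (k : ℝ) ≠ 0 := by
      have := (Finset.mem_Icc.1 hk).1
      exact_mod_cast (by omega : k ≠ 0)
    have e1 : (k : ℝ) ^ (-α) = k ^ (-1 - α) * k := by
      rw [← Real.rpow_add_one hk0]
      congr 1
      ring
    have e2 : (k : ℝ) ^ (-(α - 1)) = k ^ (-1 - α) * k ^ 2 := by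
      rw [← Real.rpow_add_natCast hk0]
      congr 1
      push_cast
      ring
    rw [e1, e2]
    ring
  have hS1 : S n α = A₁ - zr α := rfl
  have hS2 : S n (α - 1) = A₂ - zr (α - 1) := rfl
  have hp : (n : ℝ) ^ (2 - α) = n * n ^ (1 - α) := by
    rw [mul_comm, ← Real.rpow_add_one hn0.ne']
    congr 1
    ring
  rw [correctedSum_eq α hn, correctedSum_eq α hn, hsum, K1, K2, S_add_one_eq, hS1, hS2, hp]
  have h1 : 1 - α ≠ 0 := by linarith
  have h2 : 2 - α ≠ 0 := by linarith
  rw [show α * (α - 1) * (α - 2) = α * ((1 - α) * (2 - α)) by ring]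
  field_simp
  ring

namespace CubicRemainder

variable {R R₁ R₂ R₃ : ℝ → ℝ} {x M : ℝ}

theorem exists_abs_correctedSum_sub_le (H : CubicRemainder R R₁ R₂ R₃ x M) (hx : 0 < x) {α : ℝ}
    (hα0 : 0 < α) (hα1 : α < 1) :
    ∃ C : ℝ, 0 ≤ C ∧ ∀ n : ℕ, 6 ≤ n → ∀ h : ℝ, x = n * h →
      |h ^ (-α) * correctedSum α n h R - (∫ s in (0 : ℝ)..x, R₁ s * s ^ (-α)) / α|
        ≤ C * h ^ (3 - α) := by
  have hM0 := H.nonneg hx.le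
  obtain ⟨C₁, hC₁, hbulk⟩ := H.exists_abs_bulk_sum_sub_le hx hα0 hα1
  obtain ⟨C₂, hC₂, hend⟩ := exists_endpoint_coeff_bound hα0 hα1
  set G := ∫ s in (0 : ℝ)..x, R₁ s * s ^ (-α)
  refine ⟨C₁ + (|zr α| * (6 * M) + |zr (α - 1)| * (5 * M) + C₂ * M + 5 * C₂ * M
    + 4 * M + 6 * C₂ * M), by positivity, fun n hn h hxn => ?_⟩
  have hn0 : (0 : ℝ) < n := by exact_mod_cast (by omega : 0 < n)
  have hn6 : (6 : ℝ) ≤ n := by exact_mod_cast hn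
  have hh : 0 < h := by
    have : 0 < n * h := hxn ▸ hx
    exact (pos_iff_pos_of_mul_pos this).1 hn0
  have hhx : 2 * h ≤ x := by nlinarith
  obtain ⟨hS, hK1, hK2⟩ := hend n (by omega)
  have hb := hbulk n (by omega) h hxn
  set P := (n : ℝ) ^ (-α)
  have hP0 : 0 ≤ P := by positivity
  have hP1 : P ≤ 1 := Real.rpow_le_one_of_one_le_of_nonpos (by linarith) (by linarith)
  set E₁ := R (x - h) - R x + h * R₁ x with hE₁
  set E₂ := R (x - 2 * h) - R x + 2 * h * R₁ x with hE₂
  have hE₁b : |E₁| ≤ M * x * h ^ 2 := H.abs_sub_add_le hh.le (by linarith)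
  have hE₂b : |E₂| ≤ 4 * (M * x * h ^ 2) :=
    (H.abs_sub_add_le (by positivity) hhx).trans_eq (by ring)
  have hRx := H.bound₀ x ⟨hx.le, le_rfl⟩
  have hR₁x := H.bound₁ x ⟨hx.le, le_rfl⟩
  have hRh := H.bound₀ h ⟨hh.le, by linarith⟩
  have hR2h : |R (2 * h)| ≤ 8 * (M * h ^ 3) :=
    (H.bound₀ (2 * h) ⟨by positivity, hhx⟩).trans_eq (by ring)
  set W := ∑ k ∈ Finset.Ico 1 n, (k : ℝ) ^ (-1 - α) * R (k * h)
  have hQ : correctedSum α n h R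
      = (W + P * (1 / α + 1 / (2 * n) + (1 + α) / (12 * n ^ 2)) * R x
          - h * (P / (12 * n)) * R₁ x)
        + (zr α * (1 / 2 * R (2 * h) - 2 * R h) + zr (α - 1) * (R h - 1 / 2 * R (2 * h))
          + -((S n (α + 1) + P * (1 / α + 1 / (2 * n) + (1 + α) / (12 * n ^ 2))) * R x)
          + (K1 n α + P / (12 * n)) * (1 / 2 * E₂ - 2 * E₁ + h * R₁ x)
          + -(P / (12 * n) * (1 / 2 * E₂ - 2 * E₁))
          + -(K2 n α * (E₂ - 2 * E₁))) := by
    rw [correctedSum_eq α hn, Icc_one_sub_one_eq_Ico n (by omega), H.zero₀, hE₁, hE₂, ← hxn,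
      show ((n : ℝ) - 2) * h = x - 2 * h by rw [hxn]; ring,
      show ((n : ℝ) - 1) * h = x - h by rw [hxn]; ring]
    ring
  have t1 : |zr α * (1 / 2 * R (2 * h) - 2 * R h)| ≤ |zr α| * (6 * M) * h ^ 3 := by
    rw [abs_mul, mul_assoc]
    refine mul_le_mul_of_nonneg_left ?_ (abs_nonneg _)
    rw [abs_le] at *
    constructor <;> linarith
  have t2 : |zr (α - 1) * (R h - 1 / 2 * R (2 * h))| ≤ |zr (α - 1)| * (5 * M) * h ^ 3 := by
    rw [abs_mul, mul_assoc]
    refine mul_le_mul_of_nonneg_left ?_ (abs_nonneg _)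
    rw [abs_le] at *
    constructor <;> linarith
  have t3 : |-((S n (α + 1) + P * (1 / α + 1 / (2 * n) + (1 + α) / (12 * n ^ 2))) * R x)|
      ≤ C₂ * M * h ^ 3 := by
    rw [abs_neg, abs_mul]
    calc _ ≤ C₂ / n ^ 3 * (M * x ^ 3) := by gcongr
      _ = C₂ * M * h ^ 3 := by rw [hxn]; field_simp
  have hD : |1 / 2 * E₂ - 2 * E₁| ≤ 4 * (M * x * h ^ 2) := by
    rw [abs_le] at *
    constructor <;> linarith
  have t4 : |(K1 n α + P / (12 * n)) * (1 / 2 * E₂ - 2 * E₁ + h * R₁ x)|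
      ≤ 5 * C₂ * M * h ^ 3 := by
    have hD' : |1 / 2 * E₂ - 2 * E₁ + h * R₁ x| ≤ 5 * M * x ^ 2 * h := by
      have h1 : |h * R₁ x| ≤ M * x ^ 2 * h := by
        rw [abs_mul, abs_of_pos hh]
        calc h * |R₁ x| ≤ h * (M * x ^ 2) := by gcongr
          _ = _ := by ring
      have h2 : M * x * h * h ≤ M * x * h * x := by
        gcongr
        linarith
      calc _ ≤ 4 * (M * x * h ^ 2) + M * x ^ 2 * h := (abs_add_le _ _).trans (add_le_add hD h1)
        _ ≤ _ := by linarith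
    rw [abs_mul]
    calc _ ≤ C₂ / n ^ 2 * (5 * M * x ^ 2 * h) := by gcongr
      _ = 5 * C₂ * M * h ^ 3 := by rw [hxn]; field_simp
  have t5 : |-(P / (12 * n) * (1 / 2 * E₂ - 2 * E₁))| ≤ 4 * M * h ^ 3 := by
    rw [abs_neg, abs_mul, abs_of_nonneg (by positivity)]
    calc _ ≤ 1 / (1 * n) * (4 * (M * x * h ^ 2)) := by
          gcongr
          norm_num
      _ = 4 * M * h ^ 3 := by rw [hxn]; field_simp
  have t6 : |-(K2 n α * (E₂ - 2 * E₁))| ≤ 6 * C₂ * M * h ^ 3 := by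
    have hD' : |E₂ - 2 * E₁| ≤ 6 * (M * x * h ^ 2) := by
      rw [abs_le] at *
      constructor <;> linarith
    rw [abs_neg, abs_mul]
    calc _ ≤ C₂ / n * (6 * (M * x * h ^ 2)) := by gcongr
      _ = 6 * C₂ * M * h ^ 3 := by rw [hxn]; field_simp
  have e : h ^ (3 - α) = h ^ (-α) * h ^ 3 := by
    rw [← Real.rpow_add_natCast hh.ne']
    congr 1
    push_cast
    ring
  rw [hQ, mul_add, add_sub_right_comm, add_mul C₁]
  refine (abs_add_le _ _).trans (add_le_add hb ?_)
  rw [abs_mul, abs_of_nonneg (by positivity), e, mul_left_comm]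
  refine mul_le_mul_of_nonneg_left ?_ (by positivity)
  refine (abs_add_le _ _).trans ((add_le_add ((abs_add_le _ _).trans (add_le_add
    ((abs_add_le _ _).trans (add_le_add ((abs_add_le _ _).trans (add_le_add
    ((abs_add_le _ _).trans (add_le_add t1 t2)) t3)) t4)) t5)) t6).trans_eq ?_)
  ring

end CubicRemainder

/-- The second-order Taylor remainder of `t ↦ y (x - t)` at `0` is a `CubicRemainder`. -/
theorem exists_cubicRemainder {y : ℝ → ℝ} (hy : ContDiff ℝ (⊤ : ℕ∞) y) (x : ℝ) :
    ∃ (c₁ c₂ M : ℝ) (R R₁ R₂ R₃ : ℝ → ℝ), CubicRemainder R R₁ R₂ R₃ x M ∧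
      (∀ t, y (x - t) = y x + c₁ * t + c₂ * t ^ 2 + R t) ∧
      ∀ t, -deriv y (x - t) = c₁ + 2 * c₂ * t + R₁ t := by
  have hd : ∀ {g : ℝ → ℝ}, ContDiff ℝ (⊤ : ℕ∞) g →
      ContDiff ℝ (⊤ : ℕ∞) (deriv g) ∧
        ∀ t, HasDerivAt (fun u => g (x - u)) (-deriv g (x - t)) t := by
    intro g hg
    refine ⟨(contDiff_infty_iff_deriv.1 hg).2, fun t => ?_⟩
    have h1 : HasDerivAt g (deriv g (x - t)) (x - t) :=
      (hg.differentiable (by simp)).differentiableAt.hasDerivAt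
    exact (h1.comp t ((hasDerivAt_id t).const_sub x)).congr_deriv (by ring)
  obtain ⟨hy₁, d₀⟩ := hd hy
  obtain ⟨hy₂, d₁⟩ := hd hy₁
  obtain ⟨hy₃, d₂⟩ := hd hy₂
  obtain ⟨M, hM⟩ := (isCompact_Icc (a := (0 : ℝ)) (b := x)).exists_bound_of_continuousOn
    (f := fun t => -deriv (deriv (deriv y)) (x - t)) (by
      have := hy₃.continuous
      fun_prop)
  refine ⟨-deriv y x, deriv (deriv y) x / 2, M,
    fun t => y (x - t) - y x + deriv y x * t - deriv (deriv y) x / 2 * t ^ 2,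
    fun t => -deriv y (x - t) + deriv y x - deriv (deriv y) x * t,
    fun t => deriv (deriv y) (x - t) - deriv (deriv y) x,
    fun t => -deriv (deriv (deriv y)) (x - t),
    ⟨fun t => ?_, fun t => ?_, fun t => (d₂ t).sub_const _, by simp, by simp, by simp, hM⟩,
    fun t => by ring, fun t => by ring⟩
  · refine ((((d₀ t).sub_const (y x)).add ((hasDerivAt_id t).const_mul (deriv y x))).sub
      ((hasDerivAt_pow 2 t).const_mul (deriv (deriv y) x / 2))).congr_deriv ?_
    simp
    ring
  · refine ((((d₁ t).neg).add_const (deriv y x)).sub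
      ((hasDerivAt_id t).const_mul (deriv (deriv y) x))).congr_deriv ?_
    simp

theorem caputo_eq {α x : ℝ} (hα1 : α < 1) (hx : 0 ≤ x) {y : ℝ → ℝ} {R R₁ R₂ R₃ : ℝ → ℝ}
    {c₁ c₂ M : ℝ} (H : CubicRemainder R R₁ R₂ R₃ x M)
    (hd : ∀ t, -deriv y (x - t) = c₁ + 2 * c₂ * t + R₁ t) :
    caputo α y x = -(1 / Real.Gamma (1 - α)) * (c₁ * (x ^ (1 - α) / (1 - α))
      + 2 * c₂ * (x ^ (2 - α) / (2 - α)) + ∫ s in (0 : ℝ)..x, R₁ s * s ^ (-α)) := by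
  have h1 : ∫ t in (0 : ℝ)..x, deriv y t / (x - t) ^ α
      = ∫ s in (0 : ℝ)..x, deriv y (x - s) / s ^ α := by
    have := intervalIntegral.integral_comp_sub_left (a := 0) (b := x)
      (fun t => deriv y t / (x - t) ^ α) x
    simpa using this.symm
  have h2 : ∫ s in (0 : ℝ)..x, deriv y (x - s) / s ^ α
      = ∫ s in (0 : ℝ)..x,
          -(c₁ * s ^ (-α) + 2 * c₂ * s ^ (1 - α) + R₁ s * s ^ (-α)) := by
    refine intervalIntegral.integral_congr_ae (Eventually.of_forall fun s hs => ?_)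
    rw [uIoc_of_le hx] at hs
    have e : s ^ (1 - α) = s ^ (-α) * s := by
      rw [← Real.rpow_add_one hs.1.ne']
      congr 1
      ring
    rw [e, div_eq_mul_inv, ← Real.rpow_neg hs.1.le, ← neg_neg (deriv y (x - s)), hd]
    ring
  have i1 : IntervalIntegrable (fun s : ℝ => c₁ * s ^ (-α)) volume 0 x :=
    (intervalIntegral.intervalIntegrable_rpow' (by linarith)).const_mul _
  have i2 : IntervalIntegrable (fun s : ℝ => 2 * c₂ * s ^ (1 - α)) volume 0 x :=
    (intervalIntegral.intervalIntegrable_rpow' (by linarith)).const_mul _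
  rw [caputo, h1, h2, intervalIntegral.integral_neg,
    intervalIntegral.integral_add (i1.add i2) (H.intervalIntegrable hα1 0 x),
    intervalIntegral.integral_add i1 i2, intervalIntegral.integral_const_mul,
    intervalIntegral.integral_const_mul, integral_rpow (Or.inl (by linarith)),
    integral_rpow (Or.inl (by linarith)), Real.zero_rpow (by linarith),
    Real.zero_rpow (by linarith), sub_zero, sub_zero, show -α + 1 = 1 - α by ring,
    show 1 - α + 1 = 2 - α by ring]
  ring

end

theorem approx_order_three_sub_alpha
    (α x : ℝ) (hα0 : 0 < α) (hα1 : α < 1) (hx : 0 < x)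
    (y : ℝ → ℝ) (hy : ContDiff ℝ (⊤ : ℕ∞) y) :
    ∃ C > 0, ∀ n : ℕ, 6 ≤ n →
      |(1 / (Real.Gamma (-α) * (x / n) ^ α)) *
          ((-zr (1 + α) + (3 / 2) * zr α - (1 / 2) * zr (α - 1)) * y x
            + (1 - 2 * zr α + zr (α - 1)) * y (x - x / n)
            + ((2:ℝ) ^ (-1 - α) + (1 / 2) * zr α - (1 / 2) * zr (α - 1)) *
                y (x - 2 * (x / n))
            + (∑ k ∈ Finset.Icc 3 (n - 3), (k:ℝ) ^ (-1 - α) * y (x - (k:ℝ) * (x / n)))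
            + (((n:ℝ) - 2) ^ (-1 - α) + (1 / 2) * K1 n α - K2 n α) *
                y (x - ((n:ℝ) - 2) * (x / n))
            + (((n:ℝ) - 1) ^ (-1 - α) - 2 * K1 n α + 2 * K2 n α) *
                y (x - ((n:ℝ) - 1) * (x / n))
            + ((zr (1 + α) - ∑ k ∈ Finset.Icc 1 (n - 1), (k:ℝ) ^ (-1 - α))
                + (3 / 2) * K1 n α - K2 n α) * y (x - (n:ℝ) * (x / n)))
        - caputo α y x|
      ≤ C * (x / n) ^ (3 - α) := by
  obtain ⟨c₁, c₂, M, R, R₁, R₂, R₃, H, hy₀, hy₁⟩ := exists_cubicRemainder hy x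
  obtain ⟨C, hC, hbound⟩ := H.exists_abs_correctedSum_sub_le hx hα0 hα1
  have hΓ : Real.Gamma (-α) ≠ 0 := by
    refine Real.Gamma_ne_zero fun m hm => ?_
    have h1 : α = m := by linarith
    have h2 : 0 < m := by exact_mod_cast h1 ▸ hα0
    have h3 : m < 1 := by exact_mod_cast h1 ▸ hα1
    omega
  have hΓ' : Real.Gamma (1 - α) = -α * Real.Gamma (-α) := by
    rw [← Real.Gamma_add_one (by linarith), neg_add_eq_sub]
  refine ⟨C / |Real.Gamma (-α)| + 1, by positivity, fun n hn => ?_⟩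
  have hn0 : (0 : ℝ) < n := by exact_mod_cast (by omega : 0 < n)
  set h := x / n
  have hh : 0 < h := by positivity
  have hxn : x = n * h := by
    simp only [h]
    field_simp
  have hsum := correctedSum_quadratic_add hα0 hα1 hn h (y x) c₁ c₂ R
  simp_rw [← hy₀] at hsum
  rw [correctedSum, sub_zero] at hsum
  rw [hsum, caputo_eq hα1 hx.le H hy₁, hΓ']
  have e1 : x ^ (1 - α) = n ^ (1 - α) * (h ^ (-α) * h) := by
    rw [← Real.rpow_add_one hh.ne', neg_add_eq_sub, hxn, Real.mul_rpow hn0.le hh.le]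
  have e2 : x ^ (2 - α) = n ^ (2 - α) * (h ^ (-α) * h ^ 2) := by
    rw [← Real.rpow_add_natCast hh.ne', hxn, Real.mul_rpow hn0.le hh.le]
    push_cast
    rw [neg_add_eq_sub]
  have e3 : h ^ α = (h ^ (-α))⁻¹ := by rw [Real.rpow_neg hh.le, inv_inv]
  have hP : h ^ (-α) ≠ 0 := (Real.rpow_pos_of_pos hh _).ne'
  set G := ∫ s in (0 : ℝ)..x, R₁ s * s ^ (-α)
  have h1 : 1 - α ≠ 0 := by linarith
  have h2 : 2 - α ≠ 0 := by linarith
  calc _ = |(h ^ (-α) * correctedSum α n h R - G / α) / Real.Gamma (-α)| := by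
        rw [e1, e2, e3]
        congr 1
        field_simp
        ring
    _ = |h ^ (-α) * correctedSum α n h R - G / α| / |Real.Gamma (-α)| := abs_div _ _
    _ ≤ C * h ^ (3 - α) / |Real.Gamma (-α)| := by
        gcongr
        exact hbound n hn h hxn
    _ = C / |Real.Gamma (-α)| * h ^ (3 - α) := by ring
    _ ≤ _ := by
        gcongr
        linarith
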